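/- Let G be a finite simple graph. For every vertex v of a densest subgraph S* of G, the coreness of v satisfies k(v) ≥ ⌈ρ*⌉; in particular, the ⌈ρ*⌉-core of G is nonempty. -/

import Mathlib

open Finset
open scoped Classical

variable {V : Type*}

/-- `degS G S v` is the degree of `v` in the subgraph of `G` induced by the vertex set `S`. -/
noncomputable def degS [Fintype V] (G : SimpleGraph V) (S : Finset V) (v : V) : ℕ :=
  (S.filter fun u => G.Adj v u).card

/-- `edgeCount G S` is the number of edges of the subgraph of `G` induced by `S`. -/
noncomputable def edgeCount [Fintype V] (G : SimpleGraph V) (S : Finset V) : ℕ :=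
  (G.edgeFinset.filter fun ed => ∀ v ∈ ed, v ∈ S).card

/-- `density G S` is the density `|E(G[S])| / |S|` of the induced subgraph `G[S]`, as a rational. -/
noncomputable def density [Fintype V] (G : SimpleGraph V) (S : Finset V) : ℚ :=
  (edgeCount G S : ℚ) / (S.card : ℚ)

lemma edgeCount_le_erase [Fintype V] (G : SimpleGraph V) (S : Finset V) (v : V) :
    edgeCount G S ≤ edgeCount G (S.erase v) + degS G S v := by
  unfold edgeCount degS
  have hsub : (G.edgeFinset.filter fun ed => ∀ w ∈ ed, w ∈ S) ⊆
      (G.edgeFinset.filter fun ed => ∀ w ∈ ed, w ∈ S.erase v) ∪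
        (S.filter fun u => G.Adj v u).image (fun u => s(v, u)) := by
    intro ed hed
    rw [Finset.mem_filter] at hed
    obtain ⟨h1, h2⟩ := hed
    rw [Finset.mem_union]
    by_cases hv : v ∈ ed
    · right
      obtain ⟨u, rfl⟩ := Sym2.mem_iff_exists.mp hv
      rw [Finset.mem_image]
      refine ⟨u, ?_, rfl⟩
      rw [Finset.mem_filter]
      exact ⟨h2 u (Sym2.mem_mk_right v u), by simpa using h1⟩
    · left
      rw [Finset.mem_filter]
      refine ⟨h1, fun w hw => Finset.mem_erase.mpr ⟨?_, h2 w hw⟩⟩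
      rintro rfl
      exact hv hw
  refine (Finset.card_le_card hsub).trans ((Finset.card_union_le _ _).trans ?_)
  exact Nat.add_le_add_left Finset.card_image_le _

lemma edgeCount_empty [Fintype V] (G : SimpleGraph V) : edgeCount G ∅ = 0 := by
  unfold edgeCount
  rw [Finset.card_eq_zero, Finset.filter_eq_empty_iff]
  intro ed _ h
  induction ed with
  | h x y => exact absurd (h x (Sym2.mem_mk_left x y)) (Finset.notMem_empty x)

lemma density_le_degS [Fintype V] (G : SimpleGraph V) (S : Finset V)
    (hmaxd : ∀ T : Finset V, T.Nonempty → density G T ≤ density G S)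
    (v : V) (hv : v ∈ S) : density G S ≤ (degS G S v : ℚ) := by
  have hpos : (0 : ℚ) < (S.card : ℚ) := by exact_mod_cast Finset.card_pos.mpr ⟨v, hv⟩
  have hE : (edgeCount G S : ℚ) = density G S * S.card := by
    unfold density
    field_simp
  have h1 : (edgeCount G (S.erase v) : ℚ) ≤ density G S * ((S.erase v).card : ℚ) := by
    rcases (S.erase v).eq_empty_or_nonempty with h | h
    · rw [h, edgeCount_empty]
      simp
    · have hp : (0 : ℚ) < ((S.erase v).card : ℚ) := by exact_mod_cast Finset.card_pos.mpr h
      have := hmaxd _ h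
      rw [density, div_le_iff₀ hp] at this
      exact this
  have hc : ((S.erase v).card : ℚ) + 1 = S.card := by
    exact_mod_cast Finset.card_erase_add_one hv
  have h2 : (edgeCount G S : ℚ) ≤ edgeCount G (S.erase v) + degS G S v := by
    exact_mod_cast edgeCount_le_erase G S v
  rw [hE, ← hc] at h2
  linarith

/-- Every vertex of a densest subgraph has coreness at least `⌈ρ*⌉`; in particular the
`⌈ρ*⌉`-core of `G` (the maximal subset with min-degree at least `⌈ρ*⌉`) is nonempty. -/
theorem coreness_ge_ceil_density_of_mem_densest
    [Fintype V] (G : SimpleGraph V)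
    (Sstar : Finset V) (hne : Sstar.Nonempty)
    (hmaxd : ∀ S : Finset V, S.Nonempty → density G S ≤ density G Sstar)
    (kfun : V → ℕ)
    (hkfun : ∀ v : V,
      (∃ C : Finset V, v ∈ C ∧ ∀ w ∈ C, kfun v ≤ degS G C w) ∧
      (∀ k : ℕ, (∃ C : Finset V, v ∈ C ∧ ∀ w ∈ C, k ≤ degS G C w) → k ≤ kfun v))
    (C : Finset V)
    (hC : ∀ v ∈ C, ⌈density G Sstar⌉ ≤ (degS G C v : ℤ))
    (hCmax : ∀ T : Finset V,
      (∀ v ∈ T, ⌈density G Sstar⌉ ≤ (degS G T v : ℤ)) → C ⊆ T → T = C) :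
    (∀ v ∈ Sstar, ⌈density G Sstar⌉ ≤ (kfun v : ℤ)) ∧ C.Nonempty := by
  have hdeg : ∀ v ∈ Sstar, ⌈density G Sstar⌉ ≤ (degS G Sstar v : ℤ) := by
    intro v hv
    rw [Int.ceil_le]
    exact_mod_cast density_le_degS G Sstar hmaxd v hv
  refine ⟨fun v hv => ?_, ?_⟩
  · have h := (hkfun v).2 ⌈density G Sstar⌉.toNat
      ⟨Sstar, hv, fun w hw => Int.toNat_le.mpr (hdeg w hw)⟩
    exact Int.toNat_le.mp h
  · by_contra hcon
    rw [Finset.not_nonempty_iff_eq_empty] at hcon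
    have h := hCmax Sstar hdeg (by rw [hcon]; exact Finset.empty_subset _)
    rw [h, hcon] at hne
    exact Finset.not_nonempty_empty hne
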